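/- arXiv:2406.18466 — 2 statements merged into one kernel-verified Lean document; each statement's English description precedes it below -/
import Mathlib

section
/- For any even d ≥ 2 and any real c with 1/2 < c < 3/4 − 1/(4(d−1)), there exists a distribution μ on Q_d with w_i^0 ≥ c for all i ∈ {1,...,d} such that the two-player Voronoi game on Q_d with distribution μ has no equilibrium. -/
open Finset

/-- Hamming distance on the hypercube `{0,1}^d` (modelled as `Fin d → Bool`). -/
def hamming {d : ℕ} (X Y : Fin d → Bool) : ℕ :=
  (Finset.univ.filter (fun i => X i ≠ Y i)).card

/-- Number of 1-coordinates of a point of the hypercube. -/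
def nOnes {d : ℕ} (X : Fin d → Bool) : ℕ :=
  (Finset.univ.filter (fun i => X i = true)).card

/-- `μ` is a probability distribution on the hypercube. -/
def IsDistribution {d : ℕ} (μ : (Fin d → Bool) → ℝ) : Prop :=
  (∀ X, 0 ≤ μ X) ∧ ∑ X : Fin d → Bool, μ X = 1

open Classical in
/-- The weight of a set of points under `μ`. -/
noncomputable def wt {d : ℕ} (μ : (Fin d → Bool) → ℝ) (S : Set (Fin d → Bool)) : ℝ :=
  ∑ X : Fin d → Bool, if X ∈ S then μ X else 0

/-- Payoff to player 1, positioned at `A`, against player 2 positioned at `B`. -/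
noncomputable def P1 {d : ℕ} (μ : (Fin d → Bool) → ℝ) (A B : Fin d → Bool) : ℝ :=
  wt μ {X | hamming X A < hamming X B} + (1/2) * wt μ {X | hamming X A = hamming X B}

/-- Payoff to player 2, positioned at `B`, against player 1 positioned at `A`. -/
noncomputable def P2 {d : ℕ} (μ : (Fin d → Bool) → ℝ) (A B : Fin d → Bool) : ℝ :=
  wt μ {X | hamming X B < hamming X A} + (1/2) * wt μ {X | hamming X A = hamming X B}

/-- `(A,B)` is an equilibrium: neither player can strictly improve by moving. -/
def IsEquilibrium {d : ℕ} (μ : (Fin d → Bool) → ℝ) (A B : Fin d → Bool) : Prop :=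
  (∀ A', P1 μ A' B ≤ P1 μ A B) ∧ (∀ B', P2 μ A B' ≤ P2 μ A B)

/-- `w_i^0`: the weight of the subcube where coordinate `i` equals 0. -/
noncomputable def w0 {d : ℕ} (μ : (Fin d → Bool) → ℝ) (i : Fin d) : ℝ :=
  wt μ {X | X i = false}

/-- The all-zeros point `𝟎`. -/
def zeroPt (d : ℕ) : Fin d → Bool := fun _ => false

/-- The all-ones point `𝟏`. -/
def onePt (d : ℕ) : Fin d → Bool := fun _ => true

section Payoffs

variable {d : ℕ} {μ : (Fin d → Bool) → ℝ}

theorem IsDistribution.wt_mono (hμ : IsDistribution μ) {S T : Set (Fin d → Bool)} (h : S ⊆ T) :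
    wt μ S ≤ wt μ T := by
  classical
  refine Finset.sum_le_sum fun X _ => ?_
  by_cases hS : X ∈ S
  · simp [hS, h hS]
  · by_cases hT : X ∈ T <;> simp [hS, hT, hμ.1 X]

theorem wt_nonneg (hμ : IsDistribution μ) (S : Set (Fin d → Bool)) : 0 ≤ wt μ S := by
  classical
  refine Finset.sum_nonneg fun X _ => ?_
  split_ifs
  exacts [hμ.1 X, le_rfl]

theorem P1_add_P2 (hμ : IsDistribution μ) (A B : Fin d → Bool) : P1 μ A B + P2 μ A B = 1 := by
  classical
  refine Eq.trans ?_ hμ.2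
  rw [P1, P2, wt, wt, wt, Finset.mul_sum, ← Finset.sum_add_distrib,
    ← Finset.sum_add_distrib, ← Finset.sum_add_distrib]
  refine Finset.sum_congr rfl fun X _ => ?_
  simp only [Set.mem_ofPred_eq]
  rcases lt_trichotomy (hamming X A) (hamming X B) with h | h | h
  · simp [h, h.ne, h.not_gt]
  · simp only [h, lt_irrefl, if_true, if_false]
    ring
  · simp [h, h.ne', h.not_gt]

theorem P1_self (hμ : IsDistribution μ) (A : Fin d → Bool) : P1 μ A A = 1 / 2 := by
  have h := P1_add_P2 hμ A A
  have h' : P1 μ A A = P2 μ A A := rfl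
  linarith

/-- In an equilibrium the position of player 1 is unbeaten. -/
theorem IsEquilibrium.P2_le_half (hμ : IsDistribution μ) {A B : Fin d → Bool}
    (h : IsEquilibrium μ A B) (B' : Fin d → Bool) : P2 μ A B' ≤ 1 / 2 := by
  linarith [h.1 B, h.2 B', P1_self hμ B, P1_add_P2 hμ A B]

theorem hamming_update_of_eq {A X : Fin d → Bool} {i : Fin d} {b : Bool} (hA : A i ≠ b)
    (hX : X i = b) : hamming X (Function.update A i b) < hamming X A := by
  refine Finset.card_lt_card (Finset.ssubset_iff_of_subset ?_ |>.2 ⟨i, ?_, ?_⟩)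
  · intro j
    by_cases hj : j = i
    · subst hj; simp [hX]
    · simp [Function.update_of_ne hj]
  · simpa [hX] using hA.symm
  · simp [hX]

/-- A position with a 1-coordinate `i` is beaten by flipping `i`, when `w_i^0 > 1/2`. -/
theorem w0_le_P2_update (hμ : IsDistribution μ) {A : Fin d → Bool} {i : Fin d}
    (hA : A i = true) : w0 μ i ≤ P2 μ A (Function.update A i false) := by
  have h : w0 μ i ≤ wt μ {X | hamming X (Function.update A i false) < hamming X A} :=
    hμ.wt_mono fun X hX => hamming_update_of_eq (by simp [hA]) hX
  have h' := wt_nonneg hμ {X | hamming X A = hamming X (Function.update A i false)}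
  rw [P2]
  linarith

/-- If every coordinate is more often 0 than 1 and `𝟎` is beaten by some position, then there is
no equilibrium. -/
theorem not_isEquilibrium_of_beats_zeroPt (hμ : IsDistribution μ) (hw : ∀ i, 1 / 2 < w0 μ i)
    {C : Fin d → Bool} (hC : 1 / 2 < wt μ {X | hamming X C < hamming X (zeroPt d)})
    (A B : Fin d → Bool) : ¬ IsEquilibrium μ A B := by
  intro h
  by_cases hA : ∃ i, A i = true
  · obtain ⟨i, hi⟩ := hA
    linarith [hw i, w0_le_P2_update hμ hi, h.P2_le_half hμ (Function.update A i false)]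
  · have hA0 : A = zeroPt d := by
      funext i
      simpa [zeroPt] using not_exists.1 hA i
    have h1 := h.P2_le_half hμ C
    have h2 := wt_nonneg hμ {X | hamming X A = hamming X C}
    rw [P2, hA0] at h1
    rw [hA0] at h2
    linarith

end Payoffs

/-- The distribution giving weight `1 - p` to `𝟎` and weight `p` to the uniform mixture of the
points `Y j`. -/
noncomputable def mixture {d k : ℕ} (p : ℝ) (Y : Fin k → Fin d → Bool) (X : Fin d → Bool) : ℝ :=
  (1 - p) * (if X = zeroPt d then 1 else 0) + p / k * ∑ j, if X = Y j then 1 else 0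

open Classical in
theorem wt_mixture {d k : ℕ} (p : ℝ) (Y : Fin k → Fin d → Bool) (S : Set (Fin d → Bool)) :
    wt (mixture p Y) S =
      (1 - p) * (if zeroPt d ∈ S then 1 else 0) + p / k * #{j | Y j ∈ S} := by
  have h (X : Fin d → Bool) : (if X ∈ S then mixture p Y X else 0) =
      (1 - p) * (if X = zeroPt d then (if X ∈ S then 1 else 0) else 0) +
        p / k * ∑ j, if X = Y j then (if X ∈ S then 1 else 0) else 0 := by
    by_cases hX : X ∈ S <;> simp [hX, mixture]
  rw [wt, Finset.sum_congr rfl fun X _ => h X, Finset.sum_add_distrib, ← Finset.mul_sum,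
    ← Finset.mul_sum, Finset.sum_comm]
  simp

theorem isDistribution_mixture {d k : ℕ} (hk : k ≠ 0) {p : ℝ} (hp0 : 0 ≤ p) (hp1 : p ≤ 1)
    (Y : Fin k → Fin d → Bool) : IsDistribution (mixture p Y) := by
  refine ⟨fun X => ?_, ?_⟩
  · have : 0 ≤ 1 - p := by linarith
    unfold mixture
    positivity
  · have h := wt_mixture p Y Set.univ
    have hk' : (k : ℝ) ≠ 0 := by exact_mod_cast hk
    simp only [wt, Set.mem_univ, if_true, Finset.filter_true, Finset.card_univ, Fintype.card_fin,
      mul_one, div_mul_cancel₀ p hk'] at h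
    rw [h]
    ring

section CyclicBlocks

variable (r : ℕ)

/-- The `j`-th cyclic shift of a block of `r + 1` ones in the first `2 * r + 1` coordinates. -/
def cyclicBlock (j : Fin (2 * r + 1)) : Fin (2 * r + 1 + 1) → Bool :=
  Fin.snoc (α := fun _ => Bool) (fun i => decide ((i + j).val ≤ r)) false

/-- The point whose last coordinate is 0 and whose other coordinates are 1. -/
def onesButLast : Fin (2 * r + 1 + 1) → Bool :=
  Fin.snoc (α := fun _ => Bool) (fun _ => true) false

theorem card_val_gt : #{i : Fin (2 * r + 1) | r < i.val} = r := by
  have h := Fin.card_Ioi (⟨r, by omega⟩ : Fin (2 * r + 1))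
  have e : ({i | r < i.val} : Finset (Fin (2 * r + 1))) = Finset.Ioi ⟨r, by omega⟩ := by
    ext i; simp [Fin.lt_def]
  rw [e, h]
  simp
  omega

theorem card_val_add_left_gt (i : Fin (2 * r + 1)) :
    #{j : Fin (2 * r + 1) | r < (i + j).val} = r := by
  exact (Finset.card_equiv (Equiv.addLeft i) (by simp)).trans (card_val_gt r)

theorem card_val_add_right_gt (j : Fin (2 * r + 1)) :
    #{i : Fin (2 * r + 1) | r < (i + j).val} = r := by
  exact (Finset.card_equiv (Equiv.addRight j) (by simp)).trans (card_val_gt r)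

theorem card_val_add_right_le (j : Fin (2 * r + 1)) :
    #{i : Fin (2 * r + 1) | (i + j).val ≤ r} = r + 1 := by
  have h := Finset.card_filter_add_card_filter_not (s := Finset.univ)
    (fun i : Fin (2 * r + 1) => (i + j).val ≤ r)
  simp only [not_le, card_val_add_right_gt, Finset.card_univ, Fintype.card_fin] at h
  omega

theorem hamming_snoc {d : ℕ} (X Y : Fin d → Bool) (b : Bool) :
    hamming (Fin.snoc (α := fun _ => Bool) X b) (Fin.snoc (α := fun _ => Bool) Y b) =
      hamming X Y := by
  simp only [hamming, Finset.card_filter, Fin.sum_univ_castSucc, Fin.snoc_castSucc, Fin.snoc_last,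
    ne_eq, not_true_eq_false, if_false, add_zero]

theorem hamming_cyclicBlock_onesButLast (j : Fin (2 * r + 1)) :
    hamming (cyclicBlock r j) (onesButLast r) = r := by
  rw [cyclicBlock, onesButLast, hamming_snoc, hamming]
  simpa using card_val_add_right_gt r j

theorem hamming_cyclicBlock_zeroPt (j : Fin (2 * r + 1)) :
    hamming (cyclicBlock r j) (zeroPt _) = r + 1 := by
  have h : zeroPt (2 * r + 1 + 1) = Fin.snoc (α := fun _ => Bool) (fun _ => false) false := by
    funext i
    refine Fin.lastCases ?_ (fun i => ?_) i <;> simp [zeroPt]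
  rw [h, cyclicBlock, hamming_snoc, hamming]
  simpa using card_val_add_right_le r j

theorem wt_beats_zeroPt (p : ℝ) :
    p ≤ wt (mixture p (cyclicBlock r))
      {X | hamming X (onesButLast r) < hamming X (zeroPt _)} := by
  have h0 : ¬ hamming (zeroPt (2 * r + 1 + 1)) (onesButLast r) <
      hamming (zeroPt (2 * r + 1 + 1)) (zeroPt _) := by
    simp [hamming]
  have hk : ((2 * r + 1 : ℕ) : ℝ) ≠ 0 := by positivity
  rw [wt_mixture]
  simp only [Set.mem_ofPred_eq, h0, if_false, hamming_cyclicBlock_onesButLast,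
    hamming_cyclicBlock_zeroPt, Nat.lt_succ_self, Finset.filter_true, Finset.card_univ,
    Fintype.card_fin, div_mul_cancel₀ p hk]
  simp

theorem w0_castSucc (p : ℝ) (i : Fin (2 * r + 1)) :
    w0 (mixture p (cyclicBlock r)) i.castSucc = 1 - p + p / (2 * r + 1) * r := by
  rw [w0, wt_mixture]
  simp [cyclicBlock, zeroPt, card_val_add_left_gt]

theorem w0_last (p : ℝ) : w0 (mixture p (cyclicBlock r)) (Fin.last _) = 1 := by
  have hk : (2 * (r : ℝ) + 1) ≠ 0 := by positivity
  rw [w0, wt_mixture]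
  simp [cyclicBlock, zeroPt]
  field_simp
  ring

end CyclicBlocks

theorem statement_7 (d : ℕ) (hd : Even d) (hd1 : 2 ≤ d) (c : ℝ)
    (hc1 : (1:ℝ)/2 < c) (hc2 : c < (3:ℝ)/4 - 1/(4*((d:ℝ)-1))) :
    ∃ μ : (Fin d → Bool) → ℝ, IsDistribution μ ∧ (∀ i, c ≤ w0 μ i) ∧
      ∀ A B : Fin d → Bool, ¬ IsEquilibrium μ A B := by
  obtain ⟨r, rfl⟩ : ∃ r, d = 2 * r + 1 + 1 := by
    obtain ⟨m, rfl⟩ := hd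
    exact ⟨m - 1, by omega⟩
  have hr : (0 : ℝ) ≤ r := r.cast_nonneg
  have hk : (0 : ℝ) < 2 * r + 1 := by positivity
  have hc3 : c < 3 / 4 - 1 / (4 * (2 * r + 1)) := by
    push_cast at hc2
    rwa [add_sub_cancel_right] at hc2
  have hpos : 0 < 1 / (4 * (2 * (r : ℝ) + 1)) := by positivity
  set p : ℝ := 1 / 2 + (3 / 4 - 1 / (4 * (2 * r + 1)) - c) with hp
  have hμ : IsDistribution (mixture p (cyclicBlock r)) :=
    isDistribution_mixture (by omega) (by linarith) (by linarith) _
  have hw (i) : c ≤ w0 (mixture p (cyclicBlock r)) i := by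
    refine Fin.lastCases ?_ (fun i => ?_) i
    · rw [w0_last]
      linarith
    · have key : 1 - p + p / (2 * r + 1) * r = c + (p - 1 / 2) * (r / (2 * r + 1)) := by
        rw [hp]
        field_simp
        ring
      rw [w0_castSucc, key]
      have : 0 ≤ (p - 1 / 2) * (r / (2 * r + 1)) := mul_nonneg (by linarith) (by positivity)
      linarith
  exact ⟨_, hμ, hw, not_isEquilibrium_of_beats_zeroPt hμ (fun i => hc1.trans_le (hw i))
    (lt_of_lt_of_le (by linarith) (wt_beats_zeroPt r p))⟩
end

section
/- Let p_1, ..., p_d ∈ (0,1) with p_i ≠ 1/2 for all i, and let μ be the product distribution on Q_d given by μ(X) = Π_{i : x_i = 1} p_i · Π_{i : x_i = 0} (1 − p_i). Define M ∈ Q_d by M_i = 1 if p_i > 1/2 and M_i = 0 if p_i < 1/2. Then (M,M) is an equilibrium for the two-player Voronoi game on Q_d with distribution μ. -/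
open Finset

open scoped Classical

/-- The share of the voter `X` won by a player at `A` against a player at `B`. -/
noncomputable def voterShare {d : ℕ} (A B X : Fin d → Bool) : ℝ :=
  if hamming X A < hamming X B then 1 else if hamming X A = hamming X B then 1/2 else 0

lemma voterShare_nonneg {d : ℕ} (A B X : Fin d → Bool) : 0 ≤ voterShare A B X := by
  unfold voterShare
  split_ifs <;> norm_num

lemma voterShare_add_swap {d : ℕ} (A B X : Fin d → Bool) :
    voterShare A B X + voterShare B A X = 1 := by
  unfold voterShare
  split_ifs <;> first | omega | norm_num

lemma P1_eq_sum {d : ℕ} (μ : (Fin d → Bool) → ℝ) (A B : Fin d → Bool) :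
    P1 μ A B = ∑ X, voterShare A B X * μ X := by
  unfold P1 wt voterShare
  rw [Finset.mul_sum, ← Finset.sum_add_distrib]
  refine Finset.sum_congr rfl fun X _ => ?_
  simp only [Set.mem_ofPred_eq]
  split_ifs <;> first | omega | ring

lemma P2_eq_P1_swap {d : ℕ} (μ : (Fin d → Bool) → ℝ) (A B : Fin d → Bool) :
    P2 μ A B = P1 μ B A := by
  simp only [P1, P2, eq_comm]

lemma P1_add_swap {d : ℕ} (μ : (Fin d → Bool) → ℝ) (A B : Fin d → Bool) :
    P1 μ A B + P1 μ B A = ∑ X, μ X := by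
  rw [P1_eq_sum, P1_eq_sum, ← Finset.sum_add_distrib]
  refine Finset.sum_congr rfl fun X _ => ?_
  rw [← add_mul, voterShare_add_swap, one_mul]

lemma hamming_not_add {d : ℕ} (X A : Fin d → Bool) :
    hamming (fun i => !X i) A + hamming X A = d := by
  unfold hamming
  rw [Finset.card_filter, Finset.card_filter, ← Finset.sum_add_distrib]
  trans ∑ _i : Fin d, 1
  · refine Finset.sum_congr rfl fun i _ => ?_
    cases hX : X i <;> cases A i <;> simp [hX]
  · simp

/-- Complementing the voter exchanges the shares of the two players. -/
lemma voterShare_not {d : ℕ} (A B X : Fin d → Bool) :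
    voterShare A B (fun i => !X i) = voterShare B A X := by
  have hA := hamming_not_add X A
  have hB := hamming_not_add X B
  unfold voterShare
  split_ifs <;> first | omega | rfl

lemma two_mul_sum_voterShare {d : ℕ} (A B : Fin d → Bool) :
    2 * ∑ X, voterShare A B X = Fintype.card (Fin d → Bool) := by
  have hinv : Function.Involutive fun (X : Fin d → Bool) i => !X i := fun X => by simp
  have hswap : ∑ X, voterShare A B X = ∑ X, voterShare B A X := by
    rw [← Equiv.sum_comp hinv.toPerm]
    exact Finset.sum_congr rfl fun X _ => voterShare_not A B X
  rw [two_mul]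
  nth_rw 2 [hswap]
  rw [← Finset.sum_add_distrib]
  simp [voterShare_add_swap]

lemma agreement_involutive {d : ℕ} (M : Fin d → Bool) :
    Function.Involutive fun (Z : Fin d → Bool) i => (Z i == M i) := fun Z => by
  funext i
  cases h : Z i <;> cases h' : M i <;> simp [h, h']

/-- The share won by `M` increases with the set of coordinates on which the voter agrees
with `M`. -/
lemma monotone_voterShare_agreement {d : ℕ} (M A : Fin d → Bool) :
    Monotone fun Z : Fin d → Bool => voterShare M A fun i => (Z i == M i) := by
  intro Z W hZW
  have key : hamming (fun i => (W i == M i)) M + hamming (fun i => (Z i == M i)) A ≤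
      hamming (fun i => (Z i == M i)) M + hamming (fun i => (W i == M i)) A := by
    unfold hamming
    simp only [Finset.card_filter]
    rw [← Finset.sum_add_distrib, ← Finset.sum_add_distrib]
    refine Finset.sum_le_sum fun i _ => ?_
    have hi := hZW i
    revert hi
    cases Z i <;> cases W i <;> cases M i <;> cases A i <;> simp
  simp only [voterShare]
  split_ifs <;> first | omega | norm_num

/-- If the density of `μ` increases with the set of coordinates on which the point agrees
with `M`, then `M` wins at least as much as any opponent. -/
lemma P1_swap_le {d : ℕ} (μ : (Fin d → Bool) → ℝ) (M A : Fin d → Bool) (hμ : ∀ X, 0 ≤ μ X)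
    (hmono : Monotone fun Z : Fin d → Bool => μ fun i => (Z i == M i)) :
    P1 μ A M ≤ P1 μ M A := by
  let e : Equiv.Perm (Fin d → Bool) := (agreement_involutive M).toPerm
  have hfkg := fkg (fun Z => voterShare M A (e Z)) (fun Z => μ (e Z)) (fun _ => (1 : ℝ))
    (fun _ => zero_le_one) (fun Z => voterShare_nonneg M A (e Z)) (fun Z => hμ (e Z))
    (monotone_voterShare_agreement M A) hmono (fun _ _ => le_rfl)
  simp only [one_mul] at hfkg
  rw [Equiv.sum_comp e (voterShare M A), Equiv.sum_comp e μ,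
    Equiv.sum_comp e fun X => voterShare M A X * μ X, ← P1_eq_sum, ← P1_add_swap μ M A] at hfkg
  have hsum := two_mul_sum_voterShare M A
  have hpos : (0 : ℝ) < Fintype.card (Fin d → Bool) := by exact_mod_cast Fintype.card_pos
  simp only [Finset.sum_const, Finset.card_univ, nsmul_eq_mul, mul_one] at hfkg
  rw [← hsum] at hfkg hpos
  have hS : 0 < ∑ X, voterShare M A X := by linarith
  have := le_of_mul_le_mul_left (hfkg.trans_eq (by ring :
    _ = (∑ X, voterShare M A X) * (2 * P1 μ M A))) hS
  linarith

/-- If `M` wins at least as much as any opponent, then `(M, M)` is an equilibrium. -/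
lemma isEquilibrium_diag {d : ℕ} (μ : (Fin d → Bool) → ℝ) (M : Fin d → Bool)
    (h : ∀ A, P1 μ A M ≤ P1 μ M A) : IsEquilibrium μ M M := by
  have hle : ∀ A, P1 μ A M ≤ P1 μ M M := fun A => by
    linarith [h A, P1_add_swap μ A M, P1_add_swap μ M M]
  exact ⟨hle, fun B => by simpa only [P2_eq_P1_swap] using hle B⟩

theorem statement_15 (d : ℕ) (p : Fin d → ℝ)
    (hp0 : ∀ i, 0 < p i) (hp1 : ∀ i, p i < 1) (hpne : ∀ i, p i ≠ 1/2)
    (μ : (Fin d → Bool) → ℝ)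
    (hμ : μ = fun X => ∏ i : Fin d, (if X i = true then p i else 1 - p i))
    (M : Fin d → Bool) (hM : ∀ i, M i = if (1:ℝ)/2 < p i then true else false) :
    IsEquilibrium μ M M := by
  subst hμ
  have hfac : ∀ i (b : Bool), 0 ≤ if b = true then p i else 1 - p i := fun i b => by
    split_ifs <;> linarith [hp0 i, hp1 i]
  refine isEquilibrium_diag _ M fun A => P1_swap_le _ M A
    (fun X => Finset.prod_nonneg fun i _ => hfac i (X i)) fun Z W hZW => ?_
  refine Finset.prod_le_prod (fun i _ => hfac i _) fun i _ => ?_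
  have hi := hZW i
  simp only [hM i]
  revert hi
  cases Z i <;> cases W i <;> simp <;> split_ifs <;> linarith
end
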